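/- Let D be a non-trivial Steiner 3-design, i.e. a 3-(v,k,1) design with 3 < k < v. Then v - 2 ≥ (k-1)(k-2), and hence k ≤ ⌊√v + 3/2⌋. -/

import Mathlib

open Finset

/-- A `t`-`(v,k,λ)` design on the point set `X`. -/
def IsDesignOn {V : Type*} [DecidableEq V] (X : Finset V) (t v k lam : ℕ)
    (B : Finset (Finset V)) : Prop :=
  X.card = v ∧ (∀ b ∈ B, b ⊆ X ∧ b.card = k) ∧
    ∀ s ⊆ X, s.card = t → (B.filter (fun b => s ⊆ b)).card = lam

/-- Cameron: in a non-trivial Steiner 3-design (`3 < k < v`), `v - 2 ≥ (k-1)(k-2)`,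
and hence `k ≤ ⌊√v + 3/2⌋`. -/
theorem steiner3_cameron_bound {V : Type*} [DecidableEq V] (X : Finset V)
    (B : Finset (Finset V)) (v k : ℕ) (hk : 3 < k) (hkv : k < v)
    (hD : IsDesignOn X 3 v k 1 B) :
    (k - 1) * (k - 2) ≤ v - 2 ∧ k ≤ ⌊Real.sqrt v + 3 / 2⌋₊ := by
  obtain ⟨hX, hB, hS⟩ := hD
  have hex : ∀ s ⊆ X, s.card = 3 → ∃ b ∈ B, s ⊆ b := by
    intro s hs h3
    have h := hS s hs h3
    obtain ⟨b, hb⟩ := Finset.card_eq_one.mp h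
    have hm : b ∈ B.filter (fun b => s ⊆ b) := by rw [hb]; simp
    exact ⟨b, (Finset.mem_filter.mp hm).1, (Finset.mem_filter.mp hm).2⟩
  have huniq : ∀ b ∈ B, ∀ c ∈ B, ∀ x y z : V, x ≠ y → x ≠ z → y ≠ z →
      x ∈ b → y ∈ b → z ∈ b → x ∈ c → y ∈ c → z ∈ c → b = c := by
    intro b hb c hc x y z hxy hxz hyz xb yb zb xc yc zc
    have hsb : ({x, y, z} : Finset V) ⊆ b := by
      intro w hw; simp at hw; rcases hw with rfl | rfl | rfl <;> assumption
    have hsc : ({x, y, z} : Finset V) ⊆ c := by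
      intro w hw; simp at hw; rcases hw with rfl | rfl | rfl <;> assumption
    have h := hS {x, y, z} (hsb.trans (hB b hb).1) (Finset.card_eq_three.mpr ⟨x, y, z, hxy, hxz, hyz, rfl⟩)
    exact Finset.card_le_one.mp h.le b (by simp only [Finset.mem_filter]; exact ⟨hb, hsb⟩)
      c (by simp only [Finset.mem_filter]; exact ⟨hc, hsc⟩)
  have main : (k - 1) * (k - 2) ≤ v - 2 := by
    obtain ⟨s, hs, hs3⟩ := Finset.exists_subset_card_eq (show 3 ≤ X.card by omega)
    obtain ⟨b, hb, -⟩ := hex s hs hs3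
    obtain ⟨hbX, hbk⟩ := hB b hb
    obtain ⟨p, hpX, hpb⟩ := Finset.exists_mem_notMem_of_card_lt_card (show b.card < X.card by omega)
    obtain ⟨x, hx⟩ := Finset.card_pos.mp (show 0 < b.card by omega)
    have hpx : p ≠ x := fun h => hpb (h ▸ hx)
    have hc : ∀ y : V, ∃ c : Finset V, y ∈ b.erase x → c ∈ B ∧ p ∈ c ∧ x ∈ c ∧ y ∈ c := by
      intro y
      by_cases hy : y ∈ b.erase x
      · obtain ⟨hyx, hyb⟩ := Finset.mem_erase.mp hy
        obtain ⟨c, hcB, hc⟩ := hex {p, x, y}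
          (by intro w hw; simp at hw; rcases hw with rfl | rfl | rfl
              · exact hpX
              · exact hbX hx
              · exact hbX hyb)
          (Finset.card_eq_three.mpr ⟨p, x, y, hpx, fun h => hpb (h ▸ hyb), hyx.symm, rfl⟩)
        exact ⟨c, fun _ => ⟨hcB, hc (by simp), hc (by simp), hc (by simp)⟩⟩
      · exact ⟨∅, fun h => absurd h hy⟩
    choose c hc using hc
    have hdis : ((b.erase x : Finset V) : Set V).PairwiseDisjoint
        (fun y => ((c y).erase p).erase x) := by
      intro y hy y' hy' hne
      obtain ⟨h1, h2, h3, h4⟩ := hc y hy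
      obtain ⟨h1', h2', h3', h4'⟩ := hc y' hy'
      obtain ⟨hyx, hyb⟩ := Finset.mem_erase.mp (Finset.mem_coe.mp hy)
      obtain ⟨hyx', hyb'⟩ := Finset.mem_erase.mp (Finset.mem_coe.mp hy')
      refine Finset.disjoint_left.mpr fun z hz hz' => ?_
      simp only [Finset.mem_erase] at hz hz'
      have e := huniq _ h1 _ h1' p x z hpx hz.2.1.symm hz.1.symm h2 h3 hz.2.2 h2' h3' hz'.2.2
      have e2 := huniq b hb _ h1 x y y' hyx.symm hyx'.symm hne hx hyb hyb' h3 h4 (e ▸ h4')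
      exact hpb (e2 ▸ h2)
    have hcard := Finset.card_biUnion hdis
    have hsum : ∑ y ∈ b.erase x, (((c y).erase p).erase x).card = (k - 1) * (k - 2) := by
      rw [Finset.sum_const_nat (m := k - 2), Finset.card_erase_of_mem hx, hbk]
      intro y hy
      obtain ⟨h1, h2, h3, h4⟩ := hc y hy
      rw [Finset.card_erase_of_mem (Finset.mem_erase.mpr ⟨hpx.symm, h3⟩),
        Finset.card_erase_of_mem h2, (hB _ h1).2]
      omega
    have hX2 : ((X.erase p).erase x).card = v - 2 := by
      rw [Finset.card_erase_of_mem (Finset.mem_erase.mpr ⟨hpx.symm, hbX hx⟩),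
        Finset.card_erase_of_mem hpX, hX]
      omega
    rw [← hsum, ← hcard, ← hX2]
    refine Finset.card_le_card (Finset.biUnion_subset.mpr fun y hy => ?_)
    exact Finset.erase_subset_erase _ (Finset.erase_subset_erase _ (hB _ (hc y hy).1).1)
  refine ⟨main, Nat.le_floor ?_⟩
  obtain ⟨m, rfl⟩ : ∃ m, k = m + 2 := ⟨k - 2, by omega⟩
  have h2 : (m + 1) * m + 2 ≤ v := by
    have : m + 2 - 1 = m + 1 := by omega
    rw [this, Nat.add_sub_cancel] at main
    omega
  have h3 : ((m : ℝ) + 1) * m + 2 ≤ v := by exact_mod_cast h2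
  have h4 : (m : ℝ) + 1 / 2 ≤ Real.sqrt v := Real.le_sqrt_of_sq_le (by nlinarith)
  push_cast
  linarith
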